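/- Let F = 𝔽_{32003} and let f = 7056X^4 - 2016X^2Y^2 + 144Y^4 - 288XY^2Z + 2888X^2Z^2 - 196Y^2Z^2 + 56Z^4 + 144X^3W - 196X^2ZW + 56XZ^2W - 4Z^3W + Y^2W^2 - 4XZW^2 ∈ F[X, Y, Z, W]. The set of nonzero vectors v ∈ F^4 at which f and all four partial derivatives ∂f/∂X, ∂f/∂Y, ∂f/∂Z, ∂f/∂W vanish is exactly the union of the 16 lines (punctured at the origin) spanned by the vectors (0,0,0,1), (-3556,0,1,14238), (-8001,0,1,8017), (-1,0,1,50), (-16001,-16000,1,14), (-16001,16000,1,14), (-10668,-10667,1,14), (-10668,10667,1,14), (-5334,-5334,1,14), (-5334,5334,1,14), (10668,10669,1,2), (10668,-10669,1,2), (5334,5333,1,-10), (5334,-5333,1,-10), (16001,16001,1,22), (16001,-16001,1,22). In particular, the quartic surface V(f) ⊂ P^3 over F has exactly 16 singular points, all of them F-rational. -/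

import Mathlib

open MvPolynomial

/-- The Kummer quartic polynomial `f ∈ 𝔽₃₂₀₀₃[X, Y, Z, W]` (variables
`X = X 0`, `Y = X 1`, `Z = X 2`, `W = X 3`) associated to the genus-2 curve
`y² = (x-1)(x+1)(x-2)(x+2)(x-3)(x+3)`, reduced modulo `32003`. -/
noncomputable def kummerQuartic : MvPolynomial (Fin 4) (ZMod 32003) :=
  7056 * X 0 ^ 4 - 2016 * X 0 ^ 2 * X 1 ^ 2 + 144 * X 1 ^ 4
    - 288 * X 0 * X 1 ^ 2 * X 2 + 2888 * X 0 ^ 2 * X 2 ^ 2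
    - 196 * X 1 ^ 2 * X 2 ^ 2 + 56 * X 2 ^ 4 + 144 * X 0 ^ 3 * X 3
    - 196 * X 0 ^ 2 * X 2 * X 3 + 56 * X 0 * X 2 ^ 2 * X 3
    - 4 * X 2 ^ 3 * X 3 + X 1 ^ 2 * X 3 ^ 2 - 4 * X 0 * X 2 * X 3 ^ 2

/-- The coordinate vectors in `𝔽₃₂₀₀₃⁴` of the sixteen nodes of the Kummer
quartic. -/
def sixteenNodes : List (Fin 4 → ZMod 32003) :=
  [![0, 0, 0, 1],
   ![-3556, 0, 1, 14238],
   ![-8001, 0, 1, 8017],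
   ![-1, 0, 1, 50],
   ![-16001, -16000, 1, 14],
   ![-16001, 16000, 1, 14],
   ![-10668, -10667, 1, 14],
   ![-10668, 10667, 1, 14],
   ![-5334, -5334, 1, 14],
   ![-5334, 5334, 1, 14],
   ![10668, 10669, 1, 2],
   ![10668, -10669, 1, 2],
   ![5334, 5333, 1, -10],
   ![5334, -5333, 1, -10],
   ![16001, 16001, 1, 22],
   ![16001, -16001, 1, 22]]

/-- The Kummer quartic as a function of four ring elements. -/
def kummerForm {R : Type*} [CommRing R] (x y z w : R) : R :=
  7056 * x ^ 4 - 2016 * x ^ 2 * y ^ 2 + 144 * y ^ 4 - 288 * x * y ^ 2 * z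
    + 2888 * x ^ 2 * z ^ 2 - 196 * y ^ 2 * z ^ 2 + 56 * z ^ 4 + 144 * x ^ 3 * w
    - 196 * x ^ 2 * z * w + 56 * x * z ^ 2 * w - 4 * z ^ 3 * w + y ^ 2 * w ^ 2
    - 4 * x * z * w ^ 2

/-- The gradient of `kummerForm`. -/
def kummerGradient {R : Type*} [CommRing R] (x y z w : R) : Fin 4 → R :=
  ![28224 * x ^ 3 - 4032 * x * y ^ 2 - 288 * y ^ 2 * z + 5776 * x * z ^ 2 + 432 * x ^ 2 * w
      - 392 * x * z * w + 56 * z ^ 2 * w - 4 * z * w ^ 2,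
    y * (-4032 * x ^ 2 + 576 * y ^ 2 - 576 * x * z - 392 * z ^ 2 + 2 * w ^ 2),
    -288 * x * y ^ 2 + 5776 * x ^ 2 * z - 392 * y ^ 2 * z + 224 * z ^ 3 - 196 * x ^ 2 * w
      + 112 * x * z * w - 12 * z ^ 2 * w - 4 * x * w ^ 2,
    144 * x ^ 3 - 196 * x ^ 2 * z + 56 * x * z ^ 2 - 4 * z ^ 3 + 2 * y ^ 2 * w - 8 * x * z * w]

theorem eval_kummerQuartic (v : Fin 4 → ZMod 32003) :
    eval v kummerQuartic = kummerForm (v 0) (v 1) (v 2) (v 3) := by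
  simp only [kummerQuartic, kummerForm, map_add, map_sub, map_mul, map_pow, eval_X, map_ofNat]

theorem eval_pderiv_kummerQuartic (v : Fin 4 → ZMod 32003) (i : Fin 4) :
    eval v (pderiv i kummerQuartic) = kummerGradient (v 0) (v 1) (v 2) (v 3) i := by
  have h_num (n : ℕ) [n.AtLeastTwo] :
      pderiv i (OfNat.ofNat n : MvPolynomial (Fin 4) (ZMod 32003)) = 0 :=
    (pderiv i).map_natCast n
  fin_cases i <;>
  · simp only [Fin.zero_eta, Fin.mk_one, Fin.reduceFinMk] at h_num
    simp [kummerQuartic, kummerGradient, pderiv_X, Derivation.leibniz_pow, h_num]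
    ring

theorem kummerForm_mul (c x y z w : ZMod 32003) :
    kummerForm (c * x) (c * y) (c * z) (c * w) = c ^ 4 * kummerForm x y z w := by
  simp only [kummerForm]
  ring

theorem kummerGradient_mul (c x y z w : ZMod 32003) :
    kummerGradient (c * x) (c * y) (c * z) (c * w) = c ^ 3 • kummerGradient x y z w := by
  ext i
  fin_cases i <;> simp [kummerGradient] <;> ring

theorem kummerForm_kummerGradient_eq_zero_of_mem_sixteenNodes :
    ∀ v ∈ sixteenNodes, v ≠ 0 ∧ kummerForm (v 0) (v 1) (v 2) (v 3) = 0 ∧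
      kummerGradient (v 0) (v 1) (v 2) (v 3) = 0 := by
  simp only [sixteenNodes, List.forall_mem_cons, List.not_mem_nil, false_imp_iff, implies_true,
    and_true]
  refine ⟨?_, ?_, ?_, ?_, ?_, ?_, ?_, ?_, ?_, ?_, ?_, ?_, ?_, ?_, ?_, ?_⟩ <;>
  · refine ⟨by decide, ?_, ?_⟩
    · simp [kummerForm]
      try reduce_mod_char
    · ext i
      fin_cases i <;> simp [kummerGradient] <;> reduce_mod_char

theorem sixteenNodes_pairwise_minor_ne :
    sixteenNodes.Pairwise fun w w' => ∃ i j, w i * w' j ≠ w j * w' i := by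
  unfold sixteenNodes
  decide +kernel

theorem fact_prime_modulus : Fact (Nat.Prime 32003) := ⟨by norm_num⟩

section Singular

variable {x y z w : ZMod 32003}

theorem eq_zero_of_kummerGradient_zero_left (h : kummerGradient 0 y z w = 0) :
    y = 0 ∧ z = 0 := by
  have := fact_prime_modulus
  have hX := congrFun h 0
  have hY := congrFun h 1
  have hZ := congrFun h 2
  have hW := congrFun h 3
  simp [kummerGradient] at hX hY hZ hW
  have hz : z = 0 := by grind
  grind

theorem exists_node_of_kummerGradient_eq_zero_of_eq_zero
    (hx : x ≠ 0) (h : kummerGradient x 0 z w = 0) :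
    ∃ a d, ![a, 0, 1, d] ∈ sixteenNodes ∧ x = a * z ∧ w = d * z := by
  have := fact_prime_modulus
  have hX := congrFun h 0
  have hZ := congrFun h 2
  have hW := congrFun h 3
  simp [kummerGradient] at hX hZ hW
  have hz : (z + x) * (z + 4 * x) * (z + 9 * x) = 0 := by grind
  have hz' : x = -3556 * z ∨ x = -8001 * z ∨ x = -1 * z := by grind
  rcases hz' with hz | hz | hz
  · exact ⟨_, 14238, by simp [sixteenNodes], hz, by grind⟩
  · exact ⟨_, 8017, by simp [sixteenNodes], hz, by grind⟩
  · exact ⟨_, 50, by simp [sixteenNodes], hz, by grind⟩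

theorem exists_node_of_kummerGradient_eq_zero_of_ne_zero
    (hx : x ≠ 0) (hy : y ≠ 0) (h : kummerGradient x y z w = 0) :
    ∃ a b d, ![a, b, 1, d] ∈ sixteenNodes ∧ x = a * z ∧ y = b * z ∧ w = d * z := by
  have := fact_prime_modulus
  have hX := congrFun h 0
  have hY := congrFun h 1
  have hZ := congrFun h 2
  have hW := congrFun h 3
  simp [kummerGradient, hy] at hX hY hZ hW
  have hz : (z ^ 2 - 4 * x ^ 2) * (z ^ 2 - 9 * x ^ 2) * (z ^ 2 - 36 * x ^ 2) = 0 := by grind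
  have hz' : x = -16001 * z ∨ x = -10668 * z ∨ x = -5334 * z ∨ x = 10668 * z ∨ x = 5334 * z ∨
      x = 16001 * z := by grind
  rcases hz' with hz | hz | hz | hz | hz | hz
  · have hw : w = 14 * z := by grind
    have hy' : y = -16000 * z ∨ y = 16000 * z := by grind
    rcases hy' with hy' | hy' <;> exact ⟨_, _, _, by simp [sixteenNodes], hz, hy', hw⟩
  · have hw : w = 14 * z := by grind
    have hy' : y = -10667 * z ∨ y = 10667 * z := by grind
    rcases hy' with hy' | hy' <;> exact ⟨_, _, _, by simp [sixteenNodes], hz, hy', hw⟩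
  · have hw : w = 14 * z := by grind
    have hy' : y = -5334 * z ∨ y = 5334 * z := by grind
    rcases hy' with hy' | hy' <;> exact ⟨_, _, _, by simp [sixteenNodes], hz, hy', hw⟩
  · have hw : w = 2 * z := by grind
    have hy' : y = 10669 * z ∨ y = -10669 * z := by grind
    rcases hy' with hy' | hy' <;> exact ⟨_, _, _, by simp [sixteenNodes], hz, hy', hw⟩
  · have hw : w = -10 * z := by grind
    have hy' : y = 5333 * z ∨ y = -5333 * z := by grind
    rcases hy' with hy' | hy' <;> exact ⟨_, _, _, by simp [sixteenNodes], hz, hy', hw⟩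
  · have hw : w = 22 * z := by grind
    have hy' : y = 16001 * z ∨ y = -16001 * z := by grind
    rcases hy' with hy' | hy' <;> exact ⟨_, _, _, by simp [sixteenNodes], hz, hy', hw⟩

end Singular

theorem exists_node_smul_of_kummerGradient_eq_zero {v : Fin 4 → ZMod 32003} (hv : v ≠ 0)
    (h : kummerGradient (v 0) (v 1) (v 2) (v 3) = 0) :
    ∃ w ∈ sixteenNodes, ∃ c : ZMod 32003, c ≠ 0 ∧ v = c • w := by
  suffices ∃ w ∈ sixteenNodes, ∃ c : ZMod 32003, v = c • w by
    obtain ⟨w, hw, c, rfl⟩ := this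
    exact ⟨w, hw, c, fun hc => hv (by simp [hc]), rfl⟩
  by_cases hx : v 0 = 0
  · rw [hx] at h
    obtain ⟨hy, hz⟩ := eq_zero_of_kummerGradient_zero_left h
    refine ⟨![0, 0, 0, 1], by simp [sixteenNodes], v 3, ?_⟩
    ext i
    fin_cases i <;> simp [hx, hy, hz]
  suffices ∃ a b d, ![a, b, 1, d] ∈ sixteenNodes ∧
      v 0 = a * v 2 ∧ v 1 = b * v 2 ∧ v 3 = d * v 2 by
    obtain ⟨a, b, d, hm, h0, h1, h3⟩ := this
    refine ⟨_, hm, v 2, ?_⟩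
    ext i
    fin_cases i <;> simp [h0, h1, h3, mul_comm]
  by_cases hy : v 1 = 0
  · rw [hy] at h
    obtain ⟨a, d, hm, h0, h3⟩ := exists_node_of_kummerGradient_eq_zero_of_eq_zero hx h
    exact ⟨a, 0, d, hm, h0, by simpa using hy, h3⟩
  · exact exists_node_of_kummerGradient_eq_zero_of_ne_zero hx hy h

/-- The set of nonzero vectors `v ∈ 𝔽₃₂₀₀₃⁴` at which the
Kummer quartic `f` and all four of its partial derivatives vanish is exactly
the union of the sixteen punctured lines spanned by the listed node vectors;
moreover the sixteen node vectors span pairwise distinct lines, so the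
quartic surface `V(f) ⊂ P³` has exactly 16 singular points, all of them
`𝔽₃₂₀₀₃`-rational. -/
theorem kummer_quartic_sixteen_nodes :
    {v : Fin 4 → ZMod 32003 | v ≠ 0 ∧ eval v kummerQuartic = 0 ∧
        ∀ i : Fin 4, eval v (pderiv i kummerQuartic) = 0}
      = {v | ∃ w ∈ sixteenNodes, ∃ c : ZMod 32003, c ≠ 0 ∧ v = c • w} ∧
    sixteenNodes.Pairwise (fun w w' => ∀ c : ZMod 32003, w ≠ c • w') := by
  have := fact_prime_modulus
  refine ⟨?_, sixteenNodes_pairwise_minor_ne.imp ?_⟩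
  · ext v
    simp only [Set.mem_ofPred_eq, eval_kummerQuartic, eval_pderiv_kummerQuartic]
    constructor
    · rintro ⟨hv, -, h⟩
      exact exists_node_smul_of_kummerGradient_eq_zero hv (funext h)
    · rintro ⟨w, hw, c, hc, rfl⟩
      obtain ⟨hw0, hf, hg⟩ := kummerForm_kummerGradient_eq_zero_of_mem_sixteenNodes w hw
      simp only [Pi.smul_apply, smul_eq_mul, kummerForm_mul, kummerGradient_mul, hf, hg]
      simp [hc, hw0]
  · rintro w w' ⟨i, j, hij⟩ c rfl
    exact hij (by simp only [Pi.smul_apply, smul_eq_mul]; ring)
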